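/- For every real number t ∈ (0, 1], one has 2t·ln t ≥ f(t²−1), where f(x) := π + (1/2)(4+π)x − 2(x+2)·arctan(√(x+1)). -/

import Mathlib

open Real Set

noncomputable def f (x : ℝ) : ℝ :=
  π + (1 / 2) * (4 + π) * x - 2 * (x + 2) * Real.arctan (Real.sqrt (x + 1))

theorem nonneg_of_hasDerivAt_nonpos_of_right_eq_zero {g g' : ℝ → ℝ} {a b : ℝ}
    (hg : ∀ x ∈ Set.Ioc a b, HasDerivAt g (g' x) x) (hg' : ∀ x ∈ Set.Ioc a b, g' x ≤ 0)
    (hb : g b = 0) {t : ℝ} (ht : t ∈ Set.Ioc a b) : 0 ≤ g t := by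
  have hanti : AntitoneOn g (Set.Ioc a b) := by
    refine antitoneOn_of_deriv_nonpos (convex_Ioc a b)
      (fun x hx => (hg x hx).continuousAt.continuousWithinAt)
      (fun x hx => (hg x (interior_subset hx)).differentiableAt.differentiableWithinAt)
      (fun x hx => ?_)
    rw [(hg x (interior_subset hx)).deriv]
    exact hg' x (interior_subset hx)
  exact hb ▸ hanti ht ⟨ht.1.trans_le ht.2, le_rfl⟩ ht.2

theorem two_div_add_arctan_nonneg {t : ℝ} (ht : t ∈ Set.Ioc (0 : ℝ) 1) :
    0 ≤ 2 / t - (4 + π) + 4 * Real.arctan t + 4 * t / (1 + t ^ 2) := by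
  refine nonneg_of_hasDerivAt_nonpos_of_right_eq_zero
    (g := fun t => 2 / t - (4 + π) + 4 * Real.arctan t + 4 * t / (1 + t ^ 2))
    (g' := fun t => -(2 * (1 - t ^ 2) ^ 2 / (t ^ 2 * (1 + t ^ 2) ^ 2))) ?_ ?_ ?_ ht
  · intro x hx
    have hx0 : x ≠ 0 := hx.1.ne'
    have hx1 : 1 + x ^ 2 ≠ 0 := by positivity
    have h := ((((hasDerivAt_const x (2 : ℝ)).div (hasDerivAt_id x) hx0).sub_const (4 + π)).add
      ((Real.hasDerivAt_arctan x).const_mul 4)).add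
      (((hasDerivAt_id x).const_mul 4).div (((hasDerivAt_id x).pow 2).const_add 1) hx1)
    refine h.congr_deriv ?_
    simp only [id, Pi.pow_apply, Nat.cast_ofNat]
    field_simp
    ring
  · intro x _
    exact neg_nonpos.2 (by positivity)
  · simp only [Real.arctan_one]
    ring

theorem two_mul_log_add_arctan_nonpos {t : ℝ} (ht : t ∈ Set.Ioc (0 : ℝ) 1) :
    2 * Real.log t + 4 - (4 + π) * t + 4 * t * Real.arctan t ≤ 0 := by
  refine neg_nonneg.1 (nonneg_of_hasDerivAt_nonpos_of_right_eq_zero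
    (g := fun t => -(2 * Real.log t + 4 - (4 + π) * t + 4 * t * Real.arctan t))
    (g' := fun t => -(2 / t - (4 + π) + 4 * Real.arctan t + 4 * t / (1 + t ^ 2))) ?_ ?_ ?_ ht)
  · intro x hx
    have h := (((((Real.hasDerivAt_log hx.1.ne').const_mul 2).add_const 4).sub
      ((hasDerivAt_id x).const_mul (4 + π))).add
      (((hasDerivAt_id x).const_mul 4).mul (Real.hasDerivAt_arctan x))).neg
    refine h.congr_deriv ?_
    simp only [id]
    ring
  · intro x hx
    exact neg_nonpos.2 (two_div_add_arctan_nonneg hx)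
  · simp only [Real.arctan_one, Real.log_one]
    ring

theorem f_sq_sub_one {t : ℝ} (ht : 0 ≤ t) :
    f (t ^ 2 - 1) =
      π + (1 / 2) * (4 + π) * (t ^ 2 - 1) - 2 * (t ^ 2 + 1) * Real.arctan t := by
  rw [f, sub_add_cancel, Real.sqrt_sq ht]
  ring

theorem mul_log_ge (t : ℝ) (ht : t ∈ Set.Ioc (0 : ℝ) 1) :
    2 * t * Real.log t ≥ f (t ^ 2 - 1) := by
  rw [f_sq_sub_one ht.1.le, ge_iff_le, ← sub_nonneg]
  refine nonneg_of_hasDerivAt_nonpos_of_right_eq_zero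
    (g := fun t => 2 * t * Real.log t -
      (π + (1 / 2) * (4 + π) * (t ^ 2 - 1) - 2 * (t ^ 2 + 1) * Real.arctan t))
    (g' := fun t => 2 * Real.log t + 4 - (4 + π) * t + 4 * t * Real.arctan t) ?_
    (fun x hx => two_mul_log_add_arctan_nonpos hx) ?_ ht
  · intro x hx
    have hx0 : x ≠ 0 := hx.1.ne'
    have hx1 : 1 + x ^ 2 ≠ 0 := by positivity
    have hsq := (hasDerivAt_id x).pow 2
    have h := (((hasDerivAt_id x).const_mul 2).mul (Real.hasDerivAt_log hx0)).sub
      ((((hsq.sub_const 1).const_mul ((1 / 2) * (4 + π))).const_add π).sub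
      (((hsq.add_const 1).const_mul 2).mul (Real.hasDerivAt_arctan x)))
    refine h.congr_deriv ?_
    simp only [id, Pi.pow_apply, Nat.cast_ofNat]
    field_simp
    ring
  · simp only [Real.arctan_one, Real.log_one]
    ring
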